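/- With η₁, η₂ the G₂-Cartan vector fields on ℝ⁵: the iterated Lie brackets are given explicitly by [η₁, η₂] = −2 ∂/∂μ + 4λ ∂/∂τ − 4ν ∂/∂σ, [η₁, [η₁, η₂]] = 6 ∂/∂τ, and [η₂, [η₁, η₂]] = −6 ∂/∂σ. -/

import Mathlib

open scoped BigOperators

/-- The G₂-Cartan vector field `η₁ = ∂/∂λ + ν∂/∂μ − (λν−μ)∂/∂τ + ν²∂/∂σ`,
with coordinates `(λ,μ,ν,τ,σ) = (a 0, …, a 4)` on `ℝ⁵`. -/
noncomputable def eta1 (a : Fin 5 → ℝ) : Fin 5 → ℝ :=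
  ![1, a 2, 0, -(a 0 * a 2 - a 1), (a 2) ^ 2]

/-- The G₂-Cartan vector field `η₂ = ∂/∂ν − λ∂/∂μ + λ²∂/∂τ − (λν+μ)∂/∂σ`. -/
noncomputable def eta2 (a : Fin 5 → ℝ) : Fin 5 → ℝ :=
  ![0, -(a 0), 1, (a 0) ^ 2, -(a 0 * a 2 + a 1)]

/-- Lie bracket `[ξ, η](a) = Dη(a)(ξ(a)) − Dξ(a)(η(a))` of vector fields. -/
noncomputable def vbkt {E : Type*} [NormedAddCommGroup E] [NormedSpace ℝ E]
    (ξ η : E → E) (a : E) : E :=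
  fderiv ℝ η a (ξ a) - fderiv ℝ ξ a (η a)

/-- If every component of `f` has a derivative at `a` whose value on `v` is the corresponding
component of `w`, then `Df(a)(v) = w`. -/
theorem fderiv_apply_eq_of_forall_hasFDerivAt {ι E : Type*} [Fintype ι] [NormedAddCommGroup E]
    [NormedSpace ℝ E] {f : E → ι → ℝ} {a v : E} {w : ι → ℝ}
    (h : ∀ i, ∃ L : E →L[ℝ] ℝ, HasFDerivAt (fun x => f x i) L a ∧ L v = w i) :
    fderiv ℝ f a v = w := by
  choose L hL hv using h
  rw [(hasFDerivAt_pi.2 hL).fderiv]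
  exact funext hv

theorem fderiv_eta1 (a v : Fin 5 → ℝ) :
    fderiv ℝ eta1 a v = ![0, v 2, 0, -(a 0 * v 2 + a 2 * v 0 - v 1), 2 * a 2 * v 2] := by
  have h (j : Fin 5) := hasFDerivAt_apply (𝕜 := ℝ) j a
  apply fderiv_apply_eq_of_forall_hasFDerivAt
  intro i
  fin_cases i
  · exact ⟨_, hasFDerivAt_const 1 a, rfl⟩
  · exact ⟨_, h 2, rfl⟩
  · exact ⟨_, hasFDerivAt_const 0 a, rfl⟩
  · exact ⟨_, (((h 0).mul (h 2)).sub (h 1)).neg, by simp⟩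
  · exact ⟨_, (h 2).pow 2, by simp⟩

theorem fderiv_eta2 (a v : Fin 5 → ℝ) :
    fderiv ℝ eta2 a v = ![0, -v 0, 0, 2 * a 0 * v 0, -(a 0 * v 2 + a 2 * v 0 + v 1)] := by
  have h (j : Fin 5) := hasFDerivAt_apply (𝕜 := ℝ) j a
  apply fderiv_apply_eq_of_forall_hasFDerivAt
  intro i
  fin_cases i
  · exact ⟨_, hasFDerivAt_const 0 a, rfl⟩
  · exact ⟨_, (h 0).neg, by simp⟩
  · exact ⟨_, hasFDerivAt_const 1 a, rfl⟩
  · exact ⟨_, (h 0).pow 2, by simp⟩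
  · exact ⟨_, (((h 0).mul (h 2)).add (h 1)).neg, by simp⟩

theorem vbkt_eta1_eta2 :
    vbkt eta1 eta2 = fun a => ![0, -2, 0, 4 * a 0, -(4 * a 2)] := by
  funext a i
  rw [vbkt, fderiv_eta1, fderiv_eta2]
  fin_cases i <;> simp [eta1, eta2] <;> ring

theorem fderiv_vbkt_eta1_eta2 (a v : Fin 5 → ℝ) :
    fderiv ℝ (vbkt eta1 eta2) a v = ![0, 0, 0, 4 * v 0, -(4 * v 2)] := by
  have h (j : Fin 5) := hasFDerivAt_apply (𝕜 := ℝ) j a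
  rw [vbkt_eta1_eta2]
  apply fderiv_apply_eq_of_forall_hasFDerivAt
  intro i
  fin_cases i
  · exact ⟨_, hasFDerivAt_const 0 a, rfl⟩
  · exact ⟨_, hasFDerivAt_const (-2) a, rfl⟩
  · exact ⟨_, hasFDerivAt_const 0 a, rfl⟩
  · exact ⟨_, (h 0).const_mul 4, by simp⟩
  · exact ⟨_, ((h 2).const_mul 4).neg, by simp⟩

/-- the iterated Lie brackets of the G₂-Cartan vector fields are
`[η₁, η₂] = −2 ∂/∂μ + 4λ ∂/∂τ − 4ν ∂/∂σ`, `[η₁,[η₁,η₂]] = 6 ∂/∂τ`, and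
`[η₂,[η₁,η₂]] = −6 ∂/∂σ`. -/
theorem statement11 (a : Fin 5 → ℝ) :
    vbkt eta1 eta2 a = ![0, -2, 0, 4 * a 0, -(4 * a 2)] ∧
    vbkt eta1 (vbkt eta1 eta2) a = ![0, 0, 0, 6, 0] ∧
    vbkt eta2 (vbkt eta1 eta2) a = ![0, 0, 0, 0, -6] := by
  refine ⟨congrFun vbkt_eta1_eta2 a, ?_, ?_⟩
  · rw [vbkt, fderiv_vbkt_eta1_eta2, fderiv_eta1, vbkt_eta1_eta2]
    ext i
    fin_cases i <;> simp [eta1]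
    ring
  · rw [vbkt, fderiv_vbkt_eta1_eta2, fderiv_eta2, vbkt_eta1_eta2]
    ext i
    fin_cases i <;> simp [eta2]
    ring
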